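/- (Asymptotic approximation of Implicit-NTKs.) Fix σ_a ∈ ℝ with 0 < σ_a² < 1 and c ∈ (0,∞). For each n, let d = d(n) with d(n)/n → c as n → ∞, and let x₁,…,xₙ be i.i.d. random vectors uniformly distributed on the unit sphere S^{d−1} ⊂ ℝ^d, with X = [x₁,…,xₙ] ∈ ℝ^{d×n}. Let K* ∈ ℝ^{n×n} be the Implicit-NTK matrix with entries K*_{ij} = k(xᵢᵀxⱼ), where k = h ∘ g, h(x) = x/(1 − σ_a²·(π − arccos x)/π), and g(t) is the unique fixed point in [−1,1] of x = σ_a²·f(x) + (1−σ_a²)·t with f(x) = (√(1−x²) + (π − arccos x)·x)/π. Define K̄ = α̇·𝟙𝟙ᵀ + β̇·XᵀX + μ̇·Iₙ with α̇ = k(0) + k″(0)/(2d), β̇ = k′(0), μ̇ = k(1) − k(0) − k′(0). Then the spectral (operator) norm ‖K* − K̄‖₂ converges to 0 in probability as n → ∞. -/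

import Mathlib

open MeasureTheory ProbabilityTheory Real Filter
open scoped RealInnerProductSpace

/-- The dual kernel of the normalized ReLU activation `φ(x) = √2·max(x,0)`. -/
noncomputable def fDual (x : ℝ) : ℝ :=
  (Real.sqrt (1 - x ^ 2) + (Real.pi - Real.arccos x) * x) / Real.pi

/-- The map `h(x) = x/(1 − σa²·(π − arccos x)/π)` defining the Implicit-NTK. -/
noncomputable def hNTK (σa x : ℝ) : ℝ :=
  x / (1 - σa ^ 2 * (Real.pi - Real.arccos x) / Real.pi)

/-- The uniform probability distribution on the unit sphere `S^{d-1} ⊂ ℝ^d`: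
the normalization of the cone (surface) measure induced by the Lebesgue measure. -/
noncomputable def uniformSphere (d : ℕ) :
    Measure (Metric.sphere (0 : EuclideanSpace ℝ (Fin d)) 1) :=
  ((volume : Measure (EuclideanSpace ℝ (Fin d))).toSphere Set.univ)⁻¹ •
    (volume : Measure (EuclideanSpace ℝ (Fin d))).toSphere

/-- The spectral (`ℓ₂ → ℓ₂` operator) norm of a square real matrix. -/
noncomputable def opNorm {n : ℕ} (M : Matrix (Fin n) (Fin n) ℝ) : ℝ :=
  ‖LinearMap.toContinuousLinearMap (Matrix.toEuclideanLin M)‖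

section SphereMoments

variable {d : ℕ}

lemma us_isProb (hd : 0 < d) : IsProbabilityMeasure (uniformSphere d) := by
  have : Nonempty (Fin d) := ⟨⟨0, hd⟩⟩
  have : Nontrivial (EuclideanSpace ℝ (Fin d)) := inferInstance
  refine ⟨?_⟩
  have h0 : (volume : Measure (EuclideanSpace ℝ (Fin d))).toSphere Set.univ ≠ 0 := by
    rw [Ne, Measure.measure_univ_eq_zero]
    exact Measure.toSphere_ne_zero _
  have h1 : (volume : Measure (EuclideanSpace ℝ (Fin d))).toSphere Set.univ ≠ ⊤ :=
    measure_ne_top _ _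
  simp only [uniformSphere, Measure.smul_apply, smul_eq_mul]
  exact ENNReal.inv_mul_cancel h0 h1

/-- the action of a linear isometry on the sphere -/
noncomputable def sphAct (L : EuclideanSpace ℝ (Fin d) ≃ₗᵢ[ℝ] EuclideanSpace ℝ (Fin d))
    (x : Metric.sphere (0 : EuclideanSpace ℝ (Fin d)) 1) :
    Metric.sphere (0 : EuclideanSpace ℝ (Fin d)) 1 :=
  ⟨L x, by have := x.2; simp only [mem_sphere_zero_iff_norm] at this ⊢; rw [L.norm_map, this]⟩

lemma sphAct_cont (L : EuclideanSpace ℝ (Fin d) ≃ₗᵢ[ℝ] EuclideanSpace ℝ (Fin d)) :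
    Continuous (sphAct L) :=
  Continuous.subtype_mk (L.continuous.comp continuous_subtype_val) _

lemma us_map (L : EuclideanSpace ℝ (Fin d) ≃ₗᵢ[ℝ] EuclideanSpace ℝ (Fin d)) :
    (uniformSphere d).map (sphAct L) = uniformSphere d := by
  have key : ((volume : Measure (EuclideanSpace ℝ (Fin d))).toSphere).map (sphAct L)
      = (volume : Measure (EuclideanSpace ℝ (Fin d))).toSphere := by
    ext s hs
    rw [Measure.map_apply (sphAct_cont L).measurable hs, Measure.toSphere_apply' _ hs,
      Measure.toSphere_apply' _ ((sphAct_cont L).measurable hs)]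
    congr 1
    conv_rhs => rw [← (L.measurePreserving).measure_preimage_emb L.toHomeomorph.measurableEmbedding]
    congr 1
    ext y
    simp only [Set.mem_smul, Set.mem_preimage, Set.mem_image]
    constructor
    · rintro ⟨r, hr, z, ⟨w, hw, rfl⟩, rfl⟩
      refine ⟨r, hr, L w, ⟨sphAct L w, hw, rfl⟩, ?_⟩
      simp
    · rintro ⟨r, hr, z, ⟨w, hw, rfl⟩, h⟩
      have e : sphAct L (sphAct L.symm w) = w := by
        apply Subtype.ext
        simp [sphAct]
      refine ⟨r, hr, L.symm w, ⟨sphAct L.symm w, ?_, rfl⟩, ?_⟩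
      · rw [e]; exact hw
      · apply L.injective
        rw [← h]; simp
  rw [uniformSphere, Measure.map_smul, key]

lemma us_inv (L : EuclideanSpace ℝ (Fin d) ≃ₗᵢ[ℝ] EuclideanSpace ℝ (Fin d))
    (F : EuclideanSpace ℝ (Fin d) → ℝ) (hF : Continuous F) :
    ∫ x, F (L x) ∂(uniformSphere d) = ∫ x, F x ∂(uniformSphere d) := by
  conv_rhs => rw [← us_map L]
  rw [integral_map (f := fun x : Metric.sphere (0 : EuclideanSpace ℝ (Fin d)) 1 =>
    F (x : EuclideanSpace ℝ (Fin d))) (sphAct_cont L).aemeasurable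
    (hF.comp continuous_subtype_val).aestronglyMeasurable]
  rfl

lemma us_int (hd : 0 < d) (F : Metric.sphere (0 : EuclideanSpace ℝ (Fin d)) 1 → ℝ)
    (hF : Continuous F) : Integrable F (uniformSphere d) := by
  have := us_isProb hd
  exact hF.integrable_of_hasCompactSupport (HasCompactSupport.of_compactSpace F)

lemma mom_exists (hd : 0 < d) (p : ℕ) : ∃ m : ℝ, ∀ u : EuclideanSpace ℝ (Fin d),
    ∫ x, ⟪u, (x : EuclideanSpace ℝ (Fin d))⟫ ^ p ∂(uniformSphere d) = m * ‖u‖ ^ p := by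
  set e : EuclideanSpace ℝ (Fin d) := EuclideanSpace.single ⟨0, hd⟩ 1 with he
  have hen : ‖e‖ = 1 := by simp [he]
  refine ⟨∫ x, ⟪e, (x : EuclideanSpace ℝ (Fin d))⟫ ^ p ∂(uniformSphere d), fun u => ?_⟩
  have h : ‖u‖ = ‖(‖u‖ • e)‖ := by rw [norm_smul, hen]; simp
  have hr := Submodule.reflection_sub h
  set L := (ℝ ∙ (u - ‖u‖ • e))ᗮ.reflection with hL
  rw [← us_inv L (fun x => ⟪u, x⟫ ^ p) (by fun_prop), mul_comm, ← integral_const_mul]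
  congr 1
  ext x
  have : ⟪u, L (x : EuclideanSpace ℝ (Fin d))⟫ = ‖u‖ * ⟪e, (x : EuclideanSpace ℝ (Fin d))⟫ := by
    rw [← real_inner_smul_left, ← hr, ← L.inner_map_map u, ]
    congr 1
    rw [hL, Submodule.reflection_reflection]
  simp only [this, mul_pow]

lemma sph_norm (x : Metric.sphere (0 : EuclideanSpace ℝ (Fin d)) 1) :
    ‖(x : EuclideanSpace ℝ (Fin d))‖ = 1 := by
  simp

lemma sph_sum (x : Metric.sphere (0 : EuclideanSpace ℝ (Fin d)) 1) :
    ∑ i, ⟪EuclideanSpace.single i (1:ℝ), (x : EuclideanSpace ℝ (Fin d))⟫ ^ 2 = 1 := by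
  have := sph_norm x
  have h2 := EuclideanSpace.real_norm_sq_eq (x : EuclideanSpace ℝ (Fin d))
  rw [this] at h2
  simp only [EuclideanSpace.inner_single_left]
  simpa using h2.symm

lemma sgl_inner (i j : Fin d) : ⟪EuclideanSpace.single i (1:ℝ), EuclideanSpace.single j (1:ℝ)⟫
    = if i = j then 1 else 0 := by
  simp [EuclideanSpace.inner_single_left]

lemma nsq_add (u v : EuclideanSpace ℝ (Fin d)) (hu : ‖u‖ = 1) (hv : ‖v‖ = 1) :
    ‖u + v‖ ^ 2 = 2 + 2 * ⟪u, v⟫ := by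
  rw [norm_add_sq_real, hu, hv]; ring

lemma nsq_sub (u v : EuclideanSpace ℝ (Fin d)) (hu : ‖u‖ = 1) (hv : ‖v‖ = 1) :
    ‖u - v‖ ^ 2 = 2 - 2 * ⟪u, v⟫ := by
  rw [norm_sub_sq_real, hu, hv]; ring

lemma mom2 (hd : 0 < d) (u : EuclideanSpace ℝ (Fin d)) :
    ∫ x, ⟪u, (x : EuclideanSpace ℝ (Fin d))⟫ ^ 2 ∂(uniformSphere d) = 1 / d * ‖u‖ ^ 2 := by
  have := us_isProb hd
  obtain ⟨m, hm⟩ := mom_exists hd 2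
  have hd' : (d : ℝ) ≠ 0 := by positivity
  have : m = 1 / d := by
    have h : ∫ x, ∑ i, ⟪EuclideanSpace.single i (1:ℝ), (x : EuclideanSpace ℝ (Fin d))⟫ ^ 2
        ∂(uniformSphere d) = 1 := by simp only [sph_sum]; simp
    rw [integral_finsetSum _ (fun i _ => us_int hd _ (by fun_prop))] at h
    simp only [hm] at h
    simp at h
    field_simp; linarith
  rw [hm, this]

lemma mixed4 (hd : 0 < d) (m : ℝ) (hm : ∀ u : EuclideanSpace ℝ (Fin d),
    ∫ x, ⟪u, (x : EuclideanSpace ℝ (Fin d))⟫ ^ 4 ∂(uniformSphere d) = m * ‖u‖ ^ 4)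
    (u v : EuclideanSpace ℝ (Fin d)) (hu : ‖u‖ = 1) (hv : ‖v‖ = 1) :
    ∫ x, ⟪u, (x : EuclideanSpace ℝ (Fin d))⟫ ^ 2 * ⟪v, (x : EuclideanSpace ℝ (Fin d))⟫ ^ 2
      ∂(uniformSphere d) = m / 3 * (1 + 2 * ⟪u, v⟫ ^ 2) := by
  have e : ∀ x : Metric.sphere (0 : EuclideanSpace ℝ (Fin d)) 1,
      ⟪u, (x : EuclideanSpace ℝ (Fin d))⟫ ^ 2 * ⟪v, (x : EuclideanSpace ℝ (Fin d))⟫ ^ 2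
      = (1/12) * (⟪u + v, (x : EuclideanSpace ℝ (Fin d))⟫ ^ 4
        + ⟪u - v, (x : EuclideanSpace ℝ (Fin d))⟫ ^ 4)
        - (1/6) * (⟪u, (x : EuclideanSpace ℝ (Fin d))⟫ ^ 4
        + ⟪v, (x : EuclideanSpace ℝ (Fin d))⟫ ^ 4) := by
    intro x
    rw [inner_add_left, inner_sub_left]; ring
  simp only [e]
  rw [integral_sub (us_int hd _ (by fun_prop)) (us_int hd _ (by fun_prop)),
    integral_const_mul, integral_const_mul,
    integral_add (us_int hd _ (by fun_prop)) (us_int hd _ (by fun_prop)),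
    integral_add (us_int hd _ (by fun_prop)) (us_int hd _ (by fun_prop)), hm, hm, hm, hm, hu, hv,
    show ‖u + v‖ ^ 4 = (‖u + v‖ ^ 2) ^ 2 by ring, show ‖u - v‖ ^ 4 = (‖u - v‖ ^ 2) ^ 2 by ring,
    nsq_add u v hu hv, nsq_sub u v hu hv]
  ring

lemma mom4 (hd : 0 < d) (u : EuclideanSpace ℝ (Fin d)) :
    ∫ x, ⟪u, (x : EuclideanSpace ℝ (Fin d))⟫ ^ 4 ∂(uniformSphere d)
      = 3 / (d * (d + 2)) * ‖u‖ ^ 4 := by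
  have := us_isProb hd
  obtain ⟨m, hm⟩ := mom_exists hd 4
  have hd' : (d : ℝ) ≠ 0 := by positivity
  have hd2 : (d : ℝ) + 2 ≠ 0 := by positivity
  have : m = 3 / (d * (d + 2)) := by
    have h : ∫ x, ∑ i, ∑ j, ⟪EuclideanSpace.single i (1:ℝ), (x : EuclideanSpace ℝ (Fin d))⟫ ^ 2 *
        ⟪EuclideanSpace.single j (1:ℝ), (x : EuclideanSpace ℝ (Fin d))⟫ ^ 2
        ∂(uniformSphere d) = 1 := by
      simp only [← Finset.mul_sum, sph_sum, mul_one]; simp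
    rw [integral_finsetSum _ (fun i _ => us_int hd _ (by fun_prop))] at h
    have h' : ∑ i : Fin d, ∑ j : Fin d, m / 3 * (1 + 2 * (if i = j then 1 else 0) ^ 2) = 1 := by
      refine Eq.trans ?_ h
      refine Finset.sum_congr rfl fun i _ => ?_
      rw [integral_finsetSum _ (fun i _ => us_int hd _ (by fun_prop))]
      refine Finset.sum_congr rfl fun j _ => ?_
      rw [mixed4 hd m hm _ _ (by simp) (by simp), sgl_inner]
    simp [← Finset.mul_sum, Finset.sum_add_distrib, ite_pow] at h'
    field_simp
    linear_combination 3 * h'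
  rw [hm, this]

lemma mom6 (hd : 0 < d) (u : EuclideanSpace ℝ (Fin d)) :
    ∫ x, ⟪u, (x : EuclideanSpace ℝ (Fin d))⟫ ^ 6 ∂(uniformSphere d)
      = 15 / (d * (d + 2) * (d + 4)) * ‖u‖ ^ 6 := by
  have := us_isProb hd
  obtain ⟨m, hm⟩ := mom_exists hd 6
  have hd' : (d : ℝ) ≠ 0 := by positivity
  have hd2 : (d : ℝ) + 2 ≠ 0 := by positivity
  have hd4 : (d : ℝ) + 4 ≠ 0 := by positivity
  have mix : ∀ (u v : EuclideanSpace ℝ (Fin d)) (hu : ‖u‖ = 1) (hv : ‖v‖ = 1),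
    ∫ x, (⟪u, (x : EuclideanSpace ℝ (Fin d))⟫ ^ 4 * ⟪v, (x : EuclideanSpace ℝ (Fin d))⟫ ^ 2
      + ⟪u, (x : EuclideanSpace ℝ (Fin d))⟫ ^ 2 * ⟪v, (x : EuclideanSpace ℝ (Fin d))⟫ ^ 4)
      ∂(uniformSphere d) = m / 30 * (12 + 48 * ⟪u, v⟫ ^ 2) := by
    intro u v hu hv
    have e : ∀ x : Metric.sphere (0 : EuclideanSpace ℝ (Fin d)) 1,
      (⟪u, (x : EuclideanSpace ℝ (Fin d))⟫ ^ 4 * ⟪v, (x : EuclideanSpace ℝ (Fin d))⟫ ^ 2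
      + ⟪u, (x : EuclideanSpace ℝ (Fin d))⟫ ^ 2 * ⟪v, (x : EuclideanSpace ℝ (Fin d))⟫ ^ 4)
      = (1/30) * (⟪u + v, (x : EuclideanSpace ℝ (Fin d))⟫ ^ 6
        + ⟪u - v, (x : EuclideanSpace ℝ (Fin d))⟫ ^ 6)
        - (1/15) * (⟪u, (x : EuclideanSpace ℝ (Fin d))⟫ ^ 6
        + ⟪v, (x : EuclideanSpace ℝ (Fin d))⟫ ^ 6) := by
      intro x
      rw [inner_add_left, inner_sub_left]; ring
    simp only [e]
    rw [integral_sub (us_int hd _ (by fun_prop)) (us_int hd _ (by fun_prop)),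
      integral_const_mul, integral_const_mul,
      integral_add (us_int hd _ (by fun_prop)) (us_int hd _ (by fun_prop)),
      integral_add (us_int hd _ (by fun_prop)) (us_int hd _ (by fun_prop)), hm, hm, hm, hm, hu, hv,
      show ‖u + v‖ ^ 6 = (‖u + v‖ ^ 2) ^ 3 by ring, show ‖u - v‖ ^ 6 = (‖u - v‖ ^ 2) ^ 3 by ring,
      nsq_add u v hu hv, nsq_sub u v hu hv]
    ring
  have : m = 15 / (d * (d + 2) * (d + 4)) := by
    have h : ∫ x, ∑ i, ∑ j, (⟪EuclideanSpace.single i (1:ℝ), (x : EuclideanSpace ℝ (Fin d))⟫ ^ 4 *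
        ⟪EuclideanSpace.single j (1:ℝ), (x : EuclideanSpace ℝ (Fin d))⟫ ^ 2 +
        ⟪EuclideanSpace.single i (1:ℝ), (x : EuclideanSpace ℝ (Fin d))⟫ ^ 2 *
        ⟪EuclideanSpace.single j (1:ℝ), (x : EuclideanSpace ℝ (Fin d))⟫ ^ 4)
        ∂(uniformSphere d) = 2 * (d : ℝ) * (3 / ((d : ℝ) * ((d : ℝ) + 2))) := by
      simp only [Finset.sum_add_distrib, ← Finset.mul_sum, ← Finset.sum_mul, sph_sum, mul_one,
        one_mul]
      rw [integral_add (us_int hd _ (by fun_prop)) (us_int hd _ (by fun_prop)),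
        integral_finsetSum _ (fun i _ => us_int hd _ (by fun_prop))]
      simp only [mom4 hd]
      simp
      ring
    rw [integral_finsetSum _ (fun i _ => us_int hd _ (by fun_prop))] at h
    have h' : ∑ i : Fin d, ∑ j : Fin d, m / 30 * (12 + 48 * (if i = j then 1 else 0) ^ 2)
        = 2 * (d : ℝ) * (3 / ((d : ℝ) * ((d : ℝ) + 2))) := by
      refine Eq.trans ?_ h
      refine Finset.sum_congr rfl fun i _ => ?_
      rw [integral_finsetSum _ (fun i _ => us_int hd _ (by fun_prop))]
      refine Finset.sum_congr rfl fun j _ => ?_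
      rw [mix _ _ (by simp) (by simp), sgl_inner]
    simp [← Finset.mul_sum, Finset.sum_add_distrib, ite_pow] at h'
    field_simp at h' ⊢
    linear_combination (1/12) * h'
  rw [hm, this]

/-- the centred quadratic kernel -/
noncomputable def qk (d : ℕ) (u v : Metric.sphere (0 : EuclideanSpace ℝ (Fin d)) 1) : ℝ :=
  ⟪(u : EuclideanSpace ℝ (Fin d)), (v : EuclideanSpace ℝ (Fin d))⟫ ^ 2 - 1 / d

lemma qk_symm (u v : Metric.sphere (0 : EuclideanSpace ℝ (Fin d)) 1) : qk d u v = qk d v u := by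
  simp only [qk, real_inner_comm]

lemma qk_conv (hd : 0 < d) (u v : Metric.sphere (0 : EuclideanSpace ℝ (Fin d)) 1) :
    ∫ x, qk d u x * qk d v x ∂(uniformSphere d) = 2 / (d * (d + 2)) * qk d u v := by
  have := us_isProb hd
  have hd' : (d : ℝ) ≠ 0 := by positivity
  have hd2 : (d : ℝ) + 2 ≠ 0 := by positivity
  have e : ∀ x : Metric.sphere (0 : EuclideanSpace ℝ (Fin d)) 1, qk d u x * qk d v x =
      (⟪(u : EuclideanSpace ℝ (Fin d)), (x : EuclideanSpace ℝ (Fin d))⟫ ^ 2 *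
        ⟪(v : EuclideanSpace ℝ (Fin d)), (x : EuclideanSpace ℝ (Fin d))⟫ ^ 2 + (1 / d) * (1 / d))
      - (1 / d) * (⟪(u : EuclideanSpace ℝ (Fin d)), (x : EuclideanSpace ℝ (Fin d))⟫ ^ 2 +
        ⟪(v : EuclideanSpace ℝ (Fin d)), (x : EuclideanSpace ℝ (Fin d))⟫ ^ 2) := by
    intro x; simp only [qk]; ring
  simp only [e]
  rw [integral_sub (us_int hd _ (by fun_prop)) (us_int hd _ (by fun_prop)),
    integral_const_mul,
    integral_add (us_int hd _ (by fun_prop)) (us_int hd _ (by fun_prop)),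
    integral_add (us_int hd _ (by fun_prop)) (us_int hd _ (by fun_prop)), mom2 hd, mom2 hd,
    mixed4 hd _ (mom4 hd) _ _ (sph_norm u) (sph_norm v), sph_norm, sph_norm]
  simp [qk]
  field_simp
  ring

lemma qk_sq (hd : 0 < d) (u : Metric.sphere (0 : EuclideanSpace ℝ (Fin d)) 1) :
    ∫ x, qk d u x ^ 2 ∂(uniformSphere d) = 2 / (d * (d + 2)) * (1 - 1 / d) := by
  have := qk_conv hd u u
  simp only [← pow_two] at this
  rw [this]
  simp [qk, sph_norm u]

end SphereMoments

section Product

variable {d n : ℕ}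

/-- the law of the sample -/
noncomputable abbrev smp (n d : ℕ) :
    Measure (Fin n → Metric.sphere (0 : EuclideanSpace ℝ (Fin d)) 1) :=
  Measure.pi fun _ : Fin n => uniformSphere d

lemma upd_mp (hd : 0 < d) (j : Fin n) :
    MeasurePreserving (fun p : (Fin n → Metric.sphere (0 : EuclideanSpace ℝ (Fin d)) 1) ×
      Metric.sphere (0 : EuclideanSpace ℝ (Fin d)) 1 => Function.update p.1 j p.2)
      ((smp n d).prod (uniformSphere d)) (smp n d) := by
  have := us_isProb hd
  have hm : Measurable (fun p : (Fin n → Metric.sphere (0 : EuclideanSpace ℝ (Fin d)) 1) ×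
      Metric.sphere (0 : EuclideanSpace ℝ (Fin d)) 1 => Function.update p.1 j p.2) := by
    have hc : Continuous (fun p : (Fin n → Metric.sphere (0 : EuclideanSpace ℝ (Fin d)) 1) ×
      Metric.sphere (0 : EuclideanSpace ℝ (Fin d)) 1 => Function.update p.1 j p.2) :=
      Continuous.update continuous_fst j continuous_snd
    exact hc.measurable
  refine ⟨hm, ?_⟩
  symm
  apply Measure.pi_eq
  intro s hs
  rw [Measure.map_apply hm (MeasurableSet.univ_pi hs)]
  have e : (fun p : (Fin n → Metric.sphere (0 : EuclideanSpace ℝ (Fin d)) 1) ×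
      Metric.sphere (0 : EuclideanSpace ℝ (Fin d)) 1 => Function.update p.1 j p.2) ⁻¹'
      (Set.univ.pi s) = (Set.univ.pi (Function.update s j Set.univ)) ×ˢ (s j) := by
    ext ⟨ω, x⟩
    simp only [Set.mem_preimage, Set.mem_pi, Set.mem_univ, true_imp_iff, Set.mem_prod]
    constructor
    · intro h
      refine ⟨fun i => ?_, by simpa using h j⟩
      by_cases hi : i = j
      · subst hi; simp
      · simpa [Function.update_of_ne hi] using h i
    · rintro ⟨h1, h2⟩ i
      by_cases hi : i = j
      · subst hi; simpa using h2
      · simpa [Function.update_of_ne hi] using h1 i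
  rw [e, Measure.prod_prod, Measure.pi_pi, ← Finset.prod_erase_mul _ _ (Finset.mem_univ j),
    ← Finset.prod_erase_mul Finset.univ (fun i => (uniformSphere d) (s i)) (Finset.mem_univ j)]
  simp only [Function.update_self, measure_univ, mul_one]
  congr 1
  refine Finset.prod_congr rfl fun i hi => ?_
  rw [Function.update_of_ne (Finset.ne_of_mem_erase hi)]

lemma smp_int (hd : 0 < d) (F : (Fin n → Metric.sphere (0 : EuclideanSpace ℝ (Fin d)) 1) → ℝ)
    (hF : Continuous F) : Integrable F (smp n d) := by
  have := us_isProb hd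
  exact hF.integrable_of_hasCompactSupport (HasCompactSupport.of_compactSpace F)

lemma resample (hd : 0 < d) (j : Fin n)
    (F : (Fin n → Metric.sphere (0 : EuclideanSpace ℝ (Fin d)) 1) → ℝ) (hF : Continuous F) :
    ∫ ω, F ω ∂(smp n d) = ∫ ω, ∫ x, F (Function.update ω j x) ∂(uniformSphere d) ∂(smp n d) := by
  have := us_isProb hd
  have hc : Continuous (fun p : (Fin n → Metric.sphere (0 : EuclideanSpace ℝ (Fin d)) 1) ×
      Metric.sphere (0 : EuclideanSpace ℝ (Fin d)) 1 => F (Function.update p.1 j p.2)) :=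
      hF.comp (Continuous.update continuous_fst j continuous_snd)
  conv_lhs => rw [← (upd_mp hd j).map_eq]
  rw [integral_map (upd_mp hd j).measurable.aemeasurable hF.aestronglyMeasurable,
    integral_prod _ (hc.integrable_of_hasCompactSupport (HasCompactSupport.of_compactSpace _))]

@[fun_prop]
lemma qk_cont {α : Type*} [TopologicalSpace α]
    {f g : α → Metric.sphere (0 : EuclideanSpace ℝ (Fin d)) 1} (hf : Continuous f)
    (hg : Continuous g) : Continuous (fun a => qk d (f a) (g a)) := by
  unfold qk
  fun_prop

lemma E_pow (hd : 0 < d) (i j : Fin n) (hij : i ≠ j) (p : ℕ) (m : ℝ)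
    (hm : ∀ u : EuclideanSpace ℝ (Fin d),
    ∫ x, ⟪u, (x : EuclideanSpace ℝ (Fin d))⟫ ^ p ∂(uniformSphere d) = m * ‖u‖ ^ p) :
    ∫ ω, ⟪(ω i : EuclideanSpace ℝ (Fin d)), (ω j : EuclideanSpace ℝ (Fin d))⟫ ^ p ∂(smp n d)
      = m := by
  have := us_isProb hd
  rw [resample hd j _ (by fun_prop)]
  simp only [Function.update_self, Function.update_of_ne hij, hm, sph_norm]
  simp

lemma E_sq (hd : 0 < d) (i j : Fin n) (hij : i ≠ j) :
    ∫ ω, qk d (ω i) (ω j) ^ 2 ∂(smp n d) = 2 / (d * (d + 2)) * (1 - 1 / d) := by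
  have := us_isProb hd
  rw [resample hd j _ (by fun_prop)]
  simp only [Function.update_self, Function.update_of_ne hij, qk_sq hd]
  simp

lemma E_sqsq (hd : 0 < d) (i j l : Fin n) (hij : i ≠ j) (hil : i ≠ l) (hjl : j ≠ l) :
    ∫ ω, qk d (ω i) (ω j) ^ 2 * qk d (ω i) (ω l) ^ 2 ∂(smp n d)
      = (2 / (d * (d + 2)) * (1 - 1 / d)) ^ 2 := by
  have := us_isProb hd
  rw [resample hd l _ (by fun_prop)]
  simp only [Function.update_self, Function.update_of_ne hil, Function.update_of_ne hjl,
    integral_const_mul, qk_sq hd]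
  rw [integral_mul_const, E_sq hd i j hij]
  ring

lemma E_cyc (hd : 0 < d) (i j k l : Fin n) (hij : i ≠ j) (hjk : j ≠ k) (hkl : k ≠ l)
    (hli : l ≠ i) (hik : i ≠ k) (hjl : j ≠ l) :
    ∫ ω, qk d (ω i) (ω j) * qk d (ω j) (ω k) * qk d (ω k) (ω l) * qk d (ω l) (ω i) ∂(smp n d)
      = (2 / (d * (d + 2))) ^ 2 * (2 / (d * (d + 2)) * (1 - 1 / d)) := by
  have := us_isProb hd
  have e1 : ∀ ω : Fin n → Metric.sphere (0 : EuclideanSpace ℝ (Fin d)) 1,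
      qk d (ω i) (ω j) * qk d (ω j) (ω k) * qk d (ω k) (ω l) * qk d (ω l) (ω i) =
      (qk d (ω k) (ω l) * qk d (ω l) (ω i)) * (qk d (ω i) (ω j) * qk d (ω k) (ω j)) := by
    intro ω; rw [qk_symm (ω j)]; ring
  simp only [e1]
  rw [resample hd j _ (by fun_prop)]
  simp only [Function.update_self, Function.update_of_ne hij, Function.update_of_ne hjk.symm,
    Function.update_of_ne hjl.symm, integral_const_mul, qk_conv hd]
  rw [resample hd l _ (by fun_prop)]
  simp only [Function.update_self, Function.update_of_ne hli.symm, Function.update_of_ne hkl]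
  have e2 : ∀ (ω : Fin n → Metric.sphere (0 : EuclideanSpace ℝ (Fin d)) 1)
      (x : Metric.sphere (0 : EuclideanSpace ℝ (Fin d)) 1),
      qk d (ω k) x * qk d x (ω i) * (2 / (d * (d + 2)) * qk d (ω i) (ω k)) =
      (2 / (d * (d + 2)) * qk d (ω i) (ω k)) * (qk d (ω i) x * qk d (ω k) x) := by
    intro ω x; rw [qk_symm x]; ring
  simp only [e2, integral_const_mul, qk_conv hd]
  have e3 : ∀ (ω : Fin n → Metric.sphere (0 : EuclideanSpace ℝ (Fin d)) 1),
      (2 / (d * (d + 2)) * qk d (ω i) (ω k)) * (2 / (d * (d + 2)) * qk d (ω i) (ω k)) =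
      (2 / ((d : ℝ) * (d + 2))) ^ 2 * qk d (ω i) (ω k) ^ 2 := by
    intro ω; ring
  simp only [e3, integral_const_mul, E_sq hd i k hik]

lemma E_four (hd : 0 < d) (i j : Fin n) (hij : i ≠ j) :
    ∫ ω, qk d (ω i) (ω j) ^ 4 ∂(smp n d) ≤ 128 / d ^ 3 := by
  have := us_isProb hd
  have hd1 : (1:ℝ) ≤ d := by exact_mod_cast hd
  have h : ∫ ω, qk d (ω i) (ω j) ^ 4 ∂(smp n d) ≤
      ∫ ω, (8 * ⟪(ω i : EuclideanSpace ℝ (Fin d)), (ω j : EuclideanSpace ℝ (Fin d))⟫ ^ 6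
        + 8 / d ^ 3) ∂(smp n d) := by
    apply integral_mono (smp_int hd _ (by fun_prop)) (smp_int hd _ (by fun_prop))
    intro ω
    simp only [qk]
    have hab : |⟪(ω i : EuclideanSpace ℝ (Fin d)), (ω j : EuclideanSpace ℝ (Fin d))⟫| ≤ 1 := by
      have := abs_real_inner_le_norm (ω i : EuclideanSpace ℝ (Fin d))
        (ω j : EuclideanSpace ℝ (Fin d))
      simpa [sph_norm] using this
    set t := ⟪(ω i : EuclideanSpace ℝ (Fin d)), (ω j : EuclideanSpace ℝ (Fin d))⟫
    have ht2 : t ^ 2 ≤ 1 := by rw [← sq_abs]; nlinarith [abs_nonneg t]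
    have hs : (0:ℝ) ≤ 1 / d := by positivity
    have hs1 : (1:ℝ) / d ≤ 1 := by rw [div_le_one (by positivity)]; exact hd1
    have e8 : (8:ℝ) / d ^ 3 = 8 * (1 / d) ^ 3 := by ring
    rw [e8]
    have ht0 : 0 ≤ t ^ 2 := sq_nonneg t
    rw [show t ^ 6 = (t ^ 2) ^ 3 by ring]
    generalize t ^ 2 = a at *
    generalize (1:ℝ) / d = b at *
    have h1 : (a - b) ^ 4 ≤ 8 * (a ^ 4 + b ^ 4) := by
      nlinarith [sq_nonneg (a + b), sq_nonneg (a ^ 2 - b ^ 2), sq_nonneg (a - b),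
        mul_nonneg (sq_nonneg (a + b)) (sq_nonneg (a - b)), sq_nonneg ((a + b)^2),
        mul_nonneg (sq_nonneg (a + b)) (sq_nonneg a), mul_nonneg (sq_nonneg (a + b)) (sq_nonneg b)]
    have h2 : a ^ 4 ≤ a ^ 3 := pow_le_pow_of_le_one ht0 ht2 (by norm_num)
    have h3 : b ^ 4 ≤ b ^ 3 := pow_le_pow_of_le_one hs hs1 (by norm_num)
    linarith
  refine h.trans ?_
  rw [integral_add (smp_int hd _ (by fun_prop)) (smp_int hd _ (by fun_prop)), integral_const_mul,
    E_pow hd i j hij 6 _ (mom6 hd)]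
  have : (15:ℝ) / (d * (d + 2) * (d + 4)) ≤ 15 / d ^ 3 := by
    apply div_le_div_of_nonneg_left (by norm_num) (by positivity)
    nlinarith [mul_nonneg (zero_le_one.trans hd1) (zero_le_one.trans hd1)]
  simp only [integral_const, probReal_univ, smul_eq_mul, one_mul]
  calc _ ≤ 8 * ((15:ℝ) / d ^ 3) + 8 / d ^ 3 := by linarith
    _ = 128 / d ^ 3 := by ring

/-- the off-diagonal centred quadratic matrix -/
noncomputable def Mq (d : ℕ) {n : ℕ} (ω : Fin n → Metric.sphere (0 : EuclideanSpace ℝ (Fin d)) 1) :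
    Matrix (Fin n) (Fin n) ℝ :=
  Matrix.of fun i j => if i = j then 0 else qk d (ω i) (ω j)

lemma Mq_cont (i j : Fin n) : Continuous (fun ω => Mq d (n := n) ω i j) := by
  simp only [Mq, Matrix.of_apply]
  split_ifs <;> fun_prop

lemma Mq_symm (ω : Fin n → Metric.sphere (0 : EuclideanSpace ℝ (Fin d)) 1) (i j : Fin n) :
    Mq d ω i j = Mq d ω j i := by
  simp only [Mq, Matrix.of_apply, eq_comm (a := i), qk_symm (ω i)]

lemma term_bound (hd : 0 < d) (i j k l : Fin n) :
    ∫ ω, Mq d ω i j * Mq d ω j k * Mq d ω k l * Mq d ω l i ∂(smp n d) ≤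
      (if i = k then (if j = l then 128 / (d:ℝ) ^ 3 else 0) else 0)
      + (if i = k then 4 / (d:ℝ) ^ 4 else 0)
      + (if j = l then 4 / (d:ℝ) ^ 4 else 0) + 8 / (d:ℝ) ^ 6 := by
  have hd0 : (0:ℝ) < d := by exact_mod_cast hd
  have hd1 : (1:ℝ) ≤ d := by exact_mod_cast hd
  have hlam : (2:ℝ) / (d * (d + 2)) ≤ 2 / d ^ 2 := by
    apply div_le_div_of_nonneg_left (by norm_num) (by positivity); nlinarith
  have hlam0 : (0:ℝ) ≤ 2 / (d * (d + 2)) := by positivity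
  have hs : (0:ℝ) ≤ 1 / d := by positivity
  have hs1 : (1:ℝ) / d ≤ 1 := by rw [div_le_one (by positivity)]; exact hd1
  have hv0 : (0:ℝ) ≤ 2 / (d * (d + 2)) * (1 - 1 / d) := mul_nonneg hlam0 (by linarith)
  have hv : (2:ℝ) / (d * (d + 2)) * (1 - 1 / d) ≤ 2 / d ^ 2 := by
    refine le_trans ?_ hlam
    apply mul_le_of_le_one_right hlam0; linarith
  have hv2 : ((2:ℝ) / (d * (d + 2)) * (1 - 1 / d)) ^ 2 ≤ 4 / d ^ 4 := by
    calc _ ≤ ((2:ℝ) / d ^ 2) ^ 2 := by gcongr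
      _ = _ := by ring
  have hc : ((2:ℝ) / (d * (d + 2))) ^ 2 * (2 / (d * (d + 2)) * (1 - 1 / d)) ≤ 8 / d ^ 6 := by
    calc _ ≤ ((2:ℝ) / d ^ 2) ^ 2 * (2 / d ^ 2) := by gcongr
      _ = _ := by ring
  have p3 : (0:ℝ) ≤ 128 / d ^ 3 := by positivity
  have p4 : (0:ℝ) ≤ 4 / d ^ 4 := by positivity
  have p6 : (0:ℝ) ≤ 8 / d ^ 6 := by positivity
  have pos : (0:ℝ) ≤ (if i = k then (if j = l then 128 / (d:ℝ) ^ 3 else 0) else 0)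
      + (if i = k then 4 / (d:ℝ) ^ 4 else 0)
      + (if j = l then 4 / (d:ℝ) ^ 4 else 0) + 8 / (d:ℝ) ^ 6 := by
    split_ifs <;> linarith
  by_cases hij : i = j
  · simpa [Mq, hij] using pos
  by_cases hjk : j = k
  · simpa [Mq, hjk] using pos
  by_cases hkl : k = l
  · simpa [Mq, hkl] using pos
  by_cases hli : l = i
  · simpa [Mq, hli] using pos
  simp only [Mq, Matrix.of_apply, if_neg hij, if_neg hjk, if_neg hkl, if_neg hli]
  by_cases hik : i = k
  · subst hik
    by_cases hjl : j = l
    · subst hjl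
      have e : ∀ ω : Fin n → Metric.sphere (0 : EuclideanSpace ℝ (Fin d)) 1,
        qk d (ω i) (ω j) * qk d (ω j) (ω i) * qk d (ω i) (ω j) * qk d (ω j) (ω i)
        = qk d (ω i) (ω j) ^ 4 := by intro ω; rw [qk_symm (ω j)]; ring
      simp only [e, if_true]
      linarith [E_four hd i j hij]
    · have e : ∀ ω : Fin n → Metric.sphere (0 : EuclideanSpace ℝ (Fin d)) 1,
        qk d (ω i) (ω j) * qk d (ω j) (ω i) * qk d (ω i) (ω l) * qk d (ω l) (ω i)
        = qk d (ω i) (ω j) ^ 2 * qk d (ω i) (ω l) ^ 2 := by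
        intro ω; rw [qk_symm (ω j), qk_symm (ω l)]; ring
      simp only [e, if_true, if_neg hjl]
      linarith [E_sqsq hd i j l hij (Ne.symm hli) hjl]
  · by_cases hjl : j = l
    · subst hjl
      have e : ∀ ω : Fin n → Metric.sphere (0 : EuclideanSpace ℝ (Fin d)) 1,
        qk d (ω i) (ω j) * qk d (ω j) (ω k) * qk d (ω k) (ω j) * qk d (ω j) (ω i)
        = qk d (ω j) (ω i) ^ 2 * qk d (ω j) (ω k) ^ 2 := by
        intro ω; rw [qk_symm (ω i), qk_symm (ω k)]; ring
      simp only [e, if_true, if_neg hik]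
      linarith [E_sqsq hd j i k hli hjk hik]
    · rw [E_cyc hd i j k l hij hjk hkl hli hik hjl]
      simp only [if_neg hik, if_neg hjl]
      linarith

/-- `tr M⁴` -/
noncomputable def S4 (d : ℕ) {n : ℕ} (ω : Fin n → Metric.sphere (0 : EuclideanSpace ℝ (Fin d)) 1) :
    ℝ := ∑ i, ∑ k, ((Mq d ω * Mq d ω) i k) ^ 2

lemma S4_eq (ω : Fin n → Metric.sphere (0 : EuclideanSpace ℝ (Fin d)) 1) :
    S4 d ω = ∑ i, ∑ k, ∑ j, ∑ l, Mq d ω i j * Mq d ω j k * Mq d ω k l * Mq d ω l i := by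
  unfold S4
  refine Finset.sum_congr rfl fun i _ => Finset.sum_congr rfl fun k _ => ?_
  rw [pow_two, Matrix.mul_apply, Finset.sum_mul_sum]
  refine Finset.sum_congr rfl fun j _ => Finset.sum_congr rfl fun l _ => ?_
  rw [Mq_symm ω i l, Mq_symm ω l k]; ring

lemma S4_cont : Continuous (S4 d (n := n)) := by
  have : S4 d (n := n) = fun ω => ∑ i, ∑ k, ∑ j, ∑ l,
    Mq d ω i j * Mq d ω j k * Mq d ω k l * Mq d ω l i := funext S4_eq
  rw [this]
  have := @Mq_cont d n
  fun_prop

lemma E_S4 (hd : 0 < d) : ∫ ω, S4 d ω ∂(smp n d) ≤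
    128 * n ^ 2 / (d:ℝ) ^ 3 + 8 * n ^ 3 / (d:ℝ) ^ 4 + 8 * n ^ 4 / (d:ℝ) ^ 6 := by
  have hM := @Mq_cont d n
  simp only [S4_eq]
  rw [integral_finsetSum _ (fun i _ => smp_int hd _ (by fun_prop))]
  have : ∑ i : Fin n, ∑ k : Fin n, ∑ j : Fin n, ∑ l : Fin n,
      ((if i = k then (if j = l then 128 / (d:ℝ) ^ 3 else 0) else 0)
      + (if i = k then 4 / (d:ℝ) ^ 4 else 0)
      + (if j = l then 4 / (d:ℝ) ^ 4 else 0) + 8 / (d:ℝ) ^ 6) =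
      128 * n ^ 2 / (d:ℝ) ^ 3 + 8 * n ^ 3 / (d:ℝ) ^ 4 + 8 * n ^ 4 / (d:ℝ) ^ 6 := by
    simp [Finset.sum_add_distrib]
    ring
  rw [← this]
  refine Finset.sum_le_sum fun i _ => ?_
  rw [integral_finsetSum _ (fun i _ => smp_int hd _ (by fun_prop))]
  refine Finset.sum_le_sum fun k _ => ?_
  rw [integral_finsetSum _ (fun i _ => smp_int hd _ (by fun_prop))]
  refine Finset.sum_le_sum fun j _ => ?_
  rw [integral_finsetSum _ (fun i _ => smp_int hd _ (by fun_prop))]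
  exact Finset.sum_le_sum fun l _ => term_bound hd i j k l

/-- polynomial majorant for the squared Frobenius norm of the remainder -/
noncomputable def Qr (d : ℕ) {n : ℕ} (a b e : ℝ)
    (ω : Fin n → Metric.sphere (0 : EuclideanSpace ℝ (Fin d)) 1) : ℝ :=
  ∑ i, ∑ j, if i = j then a else
    (b * ⟪(ω i : EuclideanSpace ℝ (Fin d)), (ω j : EuclideanSpace ℝ (Fin d))⟫ ^ 4 +
     e * ⟪(ω i : EuclideanSpace ℝ (Fin d)), (ω j : EuclideanSpace ℝ (Fin d))⟫ ^ 6)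

lemma Qr_term_cont (a b e : ℝ) (i j : Fin n) :
    Continuous (fun ω : Fin n → Metric.sphere (0 : EuclideanSpace ℝ (Fin d)) 1 =>
    if i = j then a else
    (b * ⟪(ω i : EuclideanSpace ℝ (Fin d)), (ω j : EuclideanSpace ℝ (Fin d))⟫ ^ 4 +
     e * ⟪(ω i : EuclideanSpace ℝ (Fin d)), (ω j : EuclideanSpace ℝ (Fin d))⟫ ^ 6)) := by
  split_ifs <;> fun_prop

lemma Qr_cont (a b e : ℝ) : Continuous (Qr d (n := n) a b e) := by
  unfold Qr
  exact continuous_finsetSum _ fun i _ => continuous_finsetSum _ fun j _ =>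
    Qr_term_cont a b e i j

lemma E_Qr (hd : 0 < d) (a b e : ℝ) (ha : 0 ≤ a) (hb : 0 ≤ b) (he : 0 ≤ e) :
    ∫ ω, Qr d (n := n) a b e ω ∂(smp n d) ≤
    n * a + 3 * b * n ^ 2 / (d:ℝ) ^ 2 + 15 * e * n ^ 2 / (d:ℝ) ^ 3 := by
  have := us_isProb hd
  have hd0 : (0:ℝ) < d := by exact_mod_cast hd
  have h1 : (3:ℝ) / (d * (d + 2)) ≤ 3 / d ^ 2 := by
    apply div_le_div_of_nonneg_left (by norm_num) (by positivity); nlinarith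
  have h2 : (15:ℝ) / (d * (d + 2) * (d + 4)) ≤ 15 / d ^ 3 := by
    apply div_le_div_of_nonneg_left (by norm_num) (by positivity)
    nlinarith [mul_nonneg hd0.le hd0.le]
  unfold Qr
  rw [integral_finsetSum _ (fun i _ => smp_int hd _
    (continuous_finsetSum _ fun j _ => Qr_term_cont a b e i j))]
  have : ∑ i : Fin n, ∑ j : Fin n, ((if i = j then a else 0) +
      (b * (3 / (d:ℝ) ^ 2) + e * (15 / (d:ℝ)^3))) =
    n * a + 3 * b * n ^ 2 / (d:ℝ) ^ 2 + 15 * e * n ^ 2 / (d:ℝ) ^ 3 := by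
    simp [Finset.sum_add_distrib]
    ring
  rw [← this]
  refine Finset.sum_le_sum fun i _ => ?_
  rw [integral_finsetSum _ (fun j _ => smp_int hd _ (Qr_term_cont a b e i j))]
  refine Finset.sum_le_sum fun j _ => ?_
  have hp : 0 ≤ b * (3 / (d:ℝ) ^ 2) + e * (15 / (d:ℝ)^3) := by positivity
  by_cases hij : i = j
  · simp only [hij, if_true, integral_const, probReal_univ, smul_eq_mul, one_mul]
    linarith
  · simp only [if_neg hij]
    rw [integral_add (smp_int hd _ (by fun_prop)) (smp_int hd _ (by fun_prop)),
      integral_const_mul, integral_const_mul,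
      E_pow hd i j hij 6 _ (mom6 hd), E_pow hd i j hij 4 _ (mom4 hd)]
    rw [zero_add]
    gcongr

end Product

section OpNorm

variable {n : ℕ}

lemma opNorm_frob (M : Matrix (Fin n) (Fin n) ℝ) : opNorm M ^ 2 ≤ ∑ i, ∑ j, M i j ^ 2 := by
  have h0 : 0 ≤ ∑ i, ∑ j, M i j ^ 2 :=
    Finset.sum_nonneg fun i _ => Finset.sum_nonneg fun j _ => sq_nonneg _
  have : opNorm M ≤ Real.sqrt (∑ i, ∑ j, M i j ^ 2) := by
    unfold opNorm
    refine ContinuousLinearMap.opNorm_le_bound _ (Real.sqrt_nonneg _) fun x => ?_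
    refine abs_le_of_sq_le_sq' ?_ (by positivity) |>.2
    rw [mul_pow, Real.sq_sqrt h0, EuclideanSpace.real_norm_sq_eq, EuclideanSpace.real_norm_sq_eq,
      Finset.sum_mul]
    refine Finset.sum_le_sum fun i _ => ?_
    have e : (LinearMap.toContinuousLinearMap (Matrix.toEuclideanLin M)) x i
        = ∑ j, M i j * x j := by
      simp [Matrix.mulVec, dotProduct]
    rw [e]
    exact Finset.sum_mul_sq_le_sq_mul_sq _ _ _
  calc opNorm M ^ 2 ≤ Real.sqrt (∑ i, ∑ j, M i j ^ 2) ^ 2 := by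
        gcongr; exact norm_nonneg _
    _ = _ := Real.sq_sqrt h0

lemma opNorm_add (A B : Matrix (Fin n) (Fin n) ℝ) : opNorm (A + B) ≤ opNorm A + opNorm B := by
  unfold opNorm
  rw [map_add, map_add]
  exact norm_add_le _ _

lemma opNorm_smul (c : ℝ) (A : Matrix (Fin n) (Fin n) ℝ) : opNorm (c • A) = |c| * opNorm A := by
  unfold opNorm
  rw [map_smul, map_smul, norm_smul, Real.norm_eq_abs]

open scoped Matrix.Norms.L2Operator in
lemma opNorm_sq (A : Matrix (Fin n) (Fin n) ℝ) (hA : ∀ i j, A i j = A j i) :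
    opNorm A ^ 2 = opNorm (A * A) := by
  have h : ∀ B : Matrix (Fin n) (Fin n) ℝ, opNorm B = ‖B‖ := fun B => by
    rw [Matrix.l2_opNorm_def]; rfl
  have hs : A.conjTranspose = A := by ext i j; simp [hA i j]
  rw [h, h, pow_two, ← Matrix.l2_opNorm_conjTranspose_mul_self, hs]

lemma opNorm_four (d : ℕ) (ω : Fin n → Metric.sphere (0 : EuclideanSpace ℝ (Fin d)) 1) :
    opNorm (Mq d ω) ^ 4 ≤ S4 d ω := by
  have := opNorm_frob (Mq d ω * Mq d ω)
  rw [← opNorm_sq _ (Mq_symm ω)] at this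
  unfold S4
  linarith [show (opNorm (Mq d ω) ^ 2) ^ 2 = opNorm (Mq d ω) ^ 4 by ring]

end OpNorm

section Kernel

lemma peano2 (k : ℝ → ℝ) (h1 : ∀ᶠ t in nhds (0:ℝ), DifferentiableAt ℝ k t)
    (h2 : DifferentiableAt ℝ (deriv k) 0) (ε : ℝ) (hε : 0 < ε) :
    ∃ δ > 0, ∀ t : ℝ, |t| < δ →
      |k t - k 0 - deriv k 0 * t - deriv (deriv k) 0 / 2 * t ^ 2| ≤ ε * t ^ 2 := by
  have h3 := (hasDerivAt_iff_isLittleO.mp h2.hasDerivAt).def hε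
  obtain ⟨δ, hδ, hb⟩ := Metric.eventually_nhds_iff.mp (h1.and h3)
  refine ⟨δ, hδ, fun t ht => ?_⟩
  have key := (convex_Icc (-|t|) |t|).norm_image_sub_le_of_norm_hasDerivWithin_le
    (f := fun s => k s - k 0 - deriv k 0 * s - deriv (deriv k) 0 / 2 * s ^ 2)
    (f' := fun s => deriv k s - deriv k 0 - deriv (deriv k) 0 * s) (C := ε * |t|) (x := 0) (y := t)
    ?_ ?_ ⟨by simp, by simp⟩ ⟨neg_abs_le t, le_abs_self t⟩
  · simp only [Real.norm_eq_abs] at key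
    have e : ε * |t| * |t - 0| = ε * t ^ 2 := by rw [sub_zero, mul_assoc, ← sq, sq_abs]
    rw [e] at key
    simpa using key
  · intro s hs
    have hs' : |s| ≤ |t| := abs_le.mpr hs
    have := (hb (y := s) (by rw [Real.dist_eq, sub_zero]; linarith)).1.hasDerivAt
    have hd : HasDerivAt (fun s => k s - k 0 - deriv k 0 * s - deriv (deriv k) 0 / 2 * s ^ 2)
        (deriv k s - deriv k 0 * 1 - deriv (deriv k) 0 / 2 * (((2:ℕ):ℝ) * s ^ (2 - 1))) s :=
      ((this.sub_const _).sub ((hasDerivAt_id s).const_mul _)).sub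
        ((hasDerivAt_pow 2 s).const_mul _)
    convert hd.hasDerivWithinAt using 1
    norm_num
    ring
  · intro s hs
    have hs' : |s| ≤ |t| := abs_le.mpr hs
    have := (hb (y := s) (by rw [Real.dist_eq, sub_zero]; linarith)).2
    simp only [sub_zero, smul_eq_mul, Real.norm_eq_abs] at this ⊢
    rw [mul_comm (deriv (deriv k) 0)]
    exact this.trans (by gcongr)

lemma fDual_deriv {x : ℝ} (h1 : -1 < x) (h2 : x < 1) :
    HasDerivAt fDual ((Real.pi - Real.arccos x) / Real.pi) x := by
  have hp : 0 < 1 - x ^ 2 := by nlinarith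
  have hs : 0 < Real.sqrt (1 - x ^ 2) := Real.sqrt_pos.mpr hp
  have a1 : HasDerivAt (fun x : ℝ => 1 - x ^ 2) (-(((2:ℕ):ℝ) * x ^ (2 - 1))) x :=
    (hasDerivAt_pow 2 x).const_sub 1
  have a2 := a1.sqrt hp.ne'
  have a3 := (Real.hasDerivAt_arccos h1.ne' h2.ne).const_sub Real.pi
  have a4 := (a2.add (a3.mul (hasDerivAt_id x))).div_const Real.pi
  have : HasDerivAt fDual _ x := a4
  convert this using 1
  simp
  field_simp
  ring

lemma fDual_cont : Continuous fDual := by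
  unfold fDual
  have := Real.continuous_arccos
  fun_prop

lemma fDual_lip {x y : ℝ} (hx : x ∈ Set.Icc (-1:ℝ) 1) (hy : y ∈ Set.Icc (-1:ℝ) 1) (hxy : x ≤ y) :
    fDual y - fDual x ≤ y - x := by
  have := (convex_Icc (-1:ℝ) 1).image_sub_le_mul_sub_of_deriv_le (f := fDual) (C := 1)
    fDual_cont.continuousOn ?_ ?_ x hx y hy hxy
  · linarith
  · intro z hz
    rw [interior_Icc] at hz
    exact (fDual_deriv hz.1 hz.2).differentiableAt.differentiableWithinAt
  · intro z hz
    rw [interior_Icc] at hz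
    rw [(fDual_deriv hz.1 hz.2).deriv, div_le_one Real.pi_pos]
    linarith [Real.arccos_nonneg z]

/-- the denominator in `hNTK` -/
noncomputable def Dn (σa x : ℝ) : ℝ := 1 - σa ^ 2 * (Real.pi - Real.arccos x) / Real.pi

lemma Dn_lb (σa x : ℝ) : 1 - σa ^ 2 ≤ Dn σa x := by
  unfold Dn
  have : (Real.pi - Real.arccos x) / Real.pi ≤ 1 := by
    rw [div_le_one Real.pi_pos]
    linarith [Real.arccos_nonneg x]
  rw [mul_div_assoc]
  nlinarith [sq_nonneg σa]

/-- its derivative -/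
noncomputable def Dn' (σa x : ℝ) : ℝ := - (σa ^ 2 * (1 / Real.sqrt (1 - x ^ 2)) / Real.pi)

lemma Dn_deriv (σa : ℝ) {x : ℝ} (h1 : -1 < x) (h2 : x < 1) :
    HasDerivAt (Dn σa) (Dn' σa x) x := by
  have a3 := (Real.hasDerivAt_arccos h1.ne' h2.ne).const_sub Real.pi
  have := ((a3.const_mul (σa ^ 2)).div_const Real.pi).const_sub 1
  have h : HasDerivAt (Dn σa) _ x := this
  convert h using 1
  simp [Dn']

lemma g_lip (σa : ℝ) (hσ1 : σa ^ 2 < 1) (g : ℝ → ℝ)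
    (hg : ∀ t ∈ Set.Icc (-1 : ℝ) 1,
      g t ∈ Set.Icc (-1 : ℝ) 1 ∧ g t = σa ^ 2 * fDual (g t) + (1 - σa ^ 2) * t) {s t : ℝ} (hs : s ∈ Set.Icc (-1:ℝ) 1) (ht : t ∈ Set.Icc (-1:ℝ) 1) :
    |g t - g s| ≤ |t - s| := by
  have aux : ∀ s t : ℝ, s ∈ Set.Icc (-1:ℝ) 1 → t ∈ Set.Icc (-1:ℝ) 1 → g s ≤ g t →
      |g t - g s| ≤ |t - s| := by
    intro s t hs ht h
    obtain ⟨a1, a2⟩ := hg s hs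
    obtain ⟨b1, b2⟩ := hg t ht
    have hl := fDual_lip a1 b1 h
    rw [abs_of_nonneg (by linarith)]
    refine le_trans ?_ (le_abs_self _)
    have : g t - g s = σa ^ 2 * (fDual (g t) - fDual (g s)) + (1 - σa ^ 2) * (t - s) := by
      linarith
    nlinarith [mul_le_mul_of_nonneg_left hl (sq_nonneg σa)]
  rcases le_total (g s) (g t) with h | h
  · exact aux s t hs ht h
  · rw [abs_sub_comm, abs_sub_comm t]; exact aux t s ht hs h

lemma g_cont (σa : ℝ) (hσ1 : σa ^ 2 < 1) (g : ℝ → ℝ)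
    (hg : ∀ t ∈ Set.Icc (-1 : ℝ) 1,
      g t ∈ Set.Icc (-1 : ℝ) 1 ∧ g t = σa ^ 2 * fDual (g t) + (1 - σa ^ 2) * t) {t : ℝ} (ht : t ∈ Set.Ioo (-1:ℝ) 1) : ContinuousAt g t := by
  rw [Metric.continuousAt_iff]
  intro ε hε
  obtain ⟨δ, hδ, hb⟩ := Metric.mem_nhds_iff.mp (isOpen_Ioo.mem_nhds ht)
  refine ⟨min δ ε, lt_min hδ hε, fun x hx => ?_⟩
  have hx1 := hb (Metric.mem_ball.mpr (hx.trans_le (min_le_left _ _)))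
  rw [Real.dist_eq] at hx ⊢
  exact (g_lip σa hσ1 g hg (Set.Ioo_subset_Icc_self ht) (Set.Ioo_subset_Icc_self hx1)).trans_lt
    (hx.trans_le (min_le_right _ _))

lemma g_zero (σa : ℝ) (hσ1 : σa ^ 2 < 1) (g : ℝ → ℝ)
    (hg : ∀ t ∈ Set.Icc (-1 : ℝ) 1,
      g t ∈ Set.Icc (-1 : ℝ) 1 ∧ g t = σa ^ 2 * fDual (g t) + (1 - σa ^ 2) * t) : g 0 ∈ Set.Ioo (-1:ℝ) 1 := by
  obtain ⟨⟨a, b⟩, e⟩ := hg 0 (by norm_num)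
  refine ⟨lt_of_le_of_ne a ?_, lt_of_le_of_ne b ?_⟩
  · intro h
    rw [← h] at e
    simp [fDual] at e
  · intro h
    rw [h] at e
    simp [fDual, Real.pi_ne_zero] at e
    linarith

lemma g_deriv (σa : ℝ) (hσ1 : σa ^ 2 < 1) (g : ℝ → ℝ)
    (hg : ∀ t ∈ Set.Icc (-1 : ℝ) 1,
      g t ∈ Set.Icc (-1 : ℝ) 1 ∧ g t = σa ^ 2 * fDual (g t) + (1 - σa ^ 2) * t) {t : ℝ} (ht : t ∈ Set.Ioo (-1:ℝ) 1) (hgt : g t ∈ Set.Ioo (-1:ℝ) 1) :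
    HasDerivAt g ((1 - σa ^ 2) / Dn σa (g t)) t := by
  have hD : 0 < Dn σa (g t) := lt_of_lt_of_le (by linarith) (Dn_lb σa (g t))
  have h1 : 0 < 1 - σa ^ 2 := by linarith
  have hF : HasDerivAt (fun x => (x - σa ^ 2 * fDual x) / (1 - σa ^ 2))
      (Dn σa (g t) / (1 - σa ^ 2)) (g t) := by
    have h := ((hasDerivAt_id (g t)).sub
      ((fDual_deriv hgt.1 hgt.2).const_mul (σa ^ 2))).div_const (1 - σa ^ 2)
    have e : 1 - σa ^ 2 * ((Real.pi - Real.arccos (g t)) / Real.pi) = Dn σa (g t) := by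
      rw [Dn, mul_div_assoc]
    rw [e] at h
    exact h
  have := HasDerivAt.of_local_left_inverse (g_cont σa hσ1 g hg ht) hF
    (div_pos hD h1).ne' ?_
  · rwa [inv_div] at this
  · filter_upwards [isOpen_Ioo.mem_nhds ht] with y hy
    have := (hg y (Set.Ioo_subset_Icc_self hy)).2
    rw [div_eq_iff h1.ne']
    linarith

/-- derivative of the kernel in terms of `g` -/
noncomputable def Gk (σa x : ℝ) : ℝ :=
  (1 * Dn σa x - x * Dn' σa x) / Dn σa x ^ 2 * ((1 - σa ^ 2) / Dn σa x)

lemma k_deriv (σa : ℝ) (hσ1 : σa ^ 2 < 1) (g : ℝ → ℝ)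
    (hg : ∀ t ∈ Set.Icc (-1 : ℝ) 1,
      g t ∈ Set.Icc (-1 : ℝ) 1 ∧ g t = σa ^ 2 * fDual (g t) + (1 - σa ^ 2) * t) {t : ℝ} (ht : t ∈ Set.Ioo (-1:ℝ) 1) (hgt : g t ∈ Set.Ioo (-1:ℝ) 1) :
    HasDerivAt (hNTK σa ∘ g) (Gk σa (g t)) t := by
  have hD : 0 < Dn σa (g t) := lt_of_lt_of_le (by linarith) (Dn_lb σa (g t))
  have hh : HasDerivAt (hNTK σa) ((1 * Dn σa (g t) - g t * Dn' σa (g t)) / Dn σa (g t) ^ 2)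
      (g t) :=
    (hasDerivAt_id (g t)).div (Dn_deriv σa hgt.1 hgt.2) hD.ne'
  exact hh.comp t (g_deriv σa hσ1 g hg ht hgt)

lemma Gk_diff (σa : ℝ) (hσ1 : σa ^ 2 < 1) {x : ℝ} (hx : x ∈ Set.Ioo (-1:ℝ) 1) :
    DifferentiableAt ℝ (Gk σa) x := by
  have hD : 0 < Dn σa x := lt_of_lt_of_le (by linarith) (Dn_lb σa x)
  have d1 : DifferentiableAt ℝ (Dn σa) x := (Dn_deriv σa hx.1 hx.2).differentiableAt
  have hp : 0 < 1 - x ^ 2 := by nlinarith [hx.1, hx.2]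
  have hs : 0 < Real.sqrt (1 - x ^ 2) := Real.sqrt_pos.mpr hp
  have d2 : DifferentiableAt ℝ (Dn' σa) x := by
    unfold Dn'
    have : DifferentiableAt ℝ (fun x : ℝ => Real.sqrt (1 - x ^ 2)) x :=
      DifferentiableAt.sqrt (by fun_prop) hp.ne'
    have : DifferentiableAt ℝ (fun x : ℝ => 1 / Real.sqrt (1 - x ^ 2)) x :=
      (differentiableAt_const _).div this hs.ne'
    fun_prop
  unfold Gk
  have e1 := hD.ne'
  have e2 : Dn σa x ^ 2 ≠ 0 := by positivity
  fun_prop (disch := assumption)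

lemma k_bound (σa : ℝ) (hσ1 : σa ^ 2 < 1) (g : ℝ → ℝ)
    (hg : ∀ t ∈ Set.Icc (-1 : ℝ) 1,
      g t ∈ Set.Icc (-1 : ℝ) 1 ∧ g t = σa ^ 2 * fDual (g t) + (1 - σa ^ 2) * t) {t : ℝ} (ht : t ∈ Set.Icc (-1:ℝ) 1) :
    |(hNTK σa ∘ g) t| ≤ 1 / (1 - σa ^ 2) := by
  have h1 : 0 < 1 - σa ^ 2 := by linarith
  have hD : 0 < Dn σa (g t) := lt_of_lt_of_le (by linarith) (Dn_lb σa (g t))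
  change |g t / Dn σa (g t)| ≤ _
  rw [abs_div, abs_of_pos hD]
  exact div_le_div₀ zero_le_one (abs_le.mpr (hg t ht).1) h1 (Dn_lb σa (g t))

lemma k_rem (σa : ℝ) (hσ1 : σa ^ 2 < 1) (g : ℝ → ℝ)
    (hg : ∀ t ∈ Set.Icc (-1 : ℝ) 1,
      g t ∈ Set.Icc (-1 : ℝ) 1 ∧ g t = σa ^ 2 * fDual (g t) + (1 - σa ^ 2) * t) (b : ℝ) (hb : 0 < b) : ∃ e : ℝ, 0 ≤ e ∧ ∀ t ∈ Set.Icc (-1:ℝ) 1,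
    ((hNTK σa ∘ g) t - (hNTK σa ∘ g) 0 - deriv (hNTK σa ∘ g) 0 * t
      - deriv (deriv (hNTK σa ∘ g)) 0 / 2 * t ^ 2) ^ 2 ≤ b * t ^ 4 + e * t ^ 6 := by
  set k := hNTK σa ∘ g with hk
  have h00 : (0:ℝ) ∈ Set.Ioo (-1:ℝ) 1 := by norm_num
  have ev : ∀ᶠ t in nhds (0:ℝ), HasDerivAt k (Gk σa (g t)) t := by
    filter_upwards [isOpen_Ioo.mem_nhds h00, (g_cont σa hσ1 g hg h00).eventually
      (isOpen_Ioo.mem_nhds (g_zero σa hσ1 g hg))] with t ht hgt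
    exact k_deriv σa hσ1 g hg ht hgt
  have hdd : DifferentiableAt ℝ (deriv k) 0 := by
    have : DifferentiableAt ℝ (fun t => Gk σa (g t)) 0 :=
      (Gk_diff σa hσ1 (g_zero σa hσ1 g hg)).comp (0:ℝ)
        (g_deriv σa hσ1 g hg h00 (g_zero σa hσ1 g hg)).differentiableAt
    refine this.congr_of_eventuallyEq ?_
    filter_upwards [ev] with t ht using ht.deriv
  obtain ⟨δ, hδ, hp⟩ := peano2 k (ev.mono fun t ht => ht.differentiableAt) hdd (Real.sqrt b)
    (Real.sqrt_pos.mpr hb)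
  set k1 := deriv k 0
  set k2 := deriv (deriv k) 0
  set C := 1 / (1 - σa ^ 2) + 1 / (1 - σa ^ 2) + |k1| + |k2 / 2| with hC
  have h1 : 0 < 1 - σa ^ 2 := by linarith
  refine ⟨C ^ 2 / δ ^ 6, by positivity, fun t ht => ?_⟩
  have he : 0 ≤ C ^ 2 / δ ^ 6 := by positivity
  have ht6 : 0 ≤ t ^ 6 := by positivity
  rcases lt_or_ge |t| δ with h | h
  · have := hp t h
    have h2 : (k t - k 0 - k1 * t - k2 / 2 * t ^ 2) ^ 2 ≤ (Real.sqrt b * t ^ 2) ^ 2 := by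
      rw [← sq_abs]; gcongr
    rw [mul_pow, Real.sq_sqrt hb.le] at h2
    nlinarith [mul_nonneg he ht6]
  · have hC2 : (k t - k 0 - k1 * t - k2 / 2 * t ^ 2) ^ 2 ≤ C ^ 2 := by
      rw [← sq_abs]
      gcongr
      have b1 := k_bound σa hσ1 g hg ht
      have b2 := k_bound σa hσ1 g hg (Set.Ioo_subset_Icc_self h00)
      have t1 : |t| ≤ 1 := abs_le.mpr ht
      have b3 : |k1 * t| ≤ |k1| := by
        rw [abs_mul]; exact mul_le_of_le_one_right (abs_nonneg _) t1
      have b4 : |k2 / 2 * t ^ 2| ≤ |k2 / 2| := by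
        rw [abs_mul, abs_pow]
        exact mul_le_of_le_one_right (abs_nonneg _) (pow_le_one₀ (abs_nonneg _) t1)
      have c1 := abs_sub (k t - k 0 - k1 * t) (k2 / 2 * t ^ 2)
      have c2 := abs_sub (k t - k 0) (k1 * t)
      have c3 := abs_sub (k t) (k 0)
      linarith
    have : C ^ 2 ≤ C ^ 2 / δ ^ 6 * t ^ 6 := by
      rw [div_mul_eq_mul_div, le_div_iff₀ (by positivity)]
      have : δ ^ 6 ≤ t ^ 6 := by
        rw [← Even.pow_abs (by decide : Even 6) t]; gcongr
      gcongr
    nlinarith [mul_nonneg hb.le (show 0 ≤ t ^ 4 by positivity)]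

end Kernel

section Final

/-- the deterministic part of the argument -/
lemma det_bound {d n : ℕ} (k : ℝ → ℝ) (k1 k2 b e : ℝ)
    (hk : ∀ t ∈ Set.Icc (-1:ℝ) 1,
      (k t - k 0 - k1 * t - k2 / 2 * t ^ 2) ^ 2 ≤ b * t ^ 4 + e * t ^ 6)
    (ω : Fin n → Metric.sphere (0 : EuclideanSpace ℝ (Fin d)) 1) (ε : ℝ) (hε : 0 < ε)
    (h4 : S4 d ω < (ε / (2 * (|k2 / 2| + 1))) ^ 4)
    (hQ : Qr d ((k2 / (2 * (d:ℝ))) ^ 2) b e ω < (ε / 2) ^ 2) :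
    opNorm
      ((Matrix.of fun i j : Fin n =>
          k ⟪(ω i : EuclideanSpace ℝ (Fin d)), (ω j : EuclideanSpace ℝ (Fin d))⟫) -
        (Matrix.of fun i j : Fin n =>
          (k 0 + k2 / (2 * (d : ℝ)))
            + k1 * ⟪(ω i : EuclideanSpace ℝ (Fin d)), (ω j : EuclideanSpace ℝ (Fin d))⟫
            + (k 1 - k 0 - k1) * (if i = j then 1 else 0))) ≤ ε := by
  set Δ := ((Matrix.of fun i j : Fin n =>
          k ⟪(ω i : EuclideanSpace ℝ (Fin d)), (ω j : EuclideanSpace ℝ (Fin d))⟫) -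
        (Matrix.of fun i j : Fin n =>
          (k 0 + k2 / (2 * (d : ℝ)))
            + k1 * ⟪(ω i : EuclideanSpace ℝ (Fin d)), (ω j : EuclideanSpace ℝ (Fin d))⟫
            + (k 1 - k 0 - k1) * (if i = j then 1 else 0))) with hΔ
  set A := |k2 / 2| with hA
  have hA0 : 0 ≤ A := abs_nonneg _
  have hM : opNorm (Mq d ω) < ε / (2 * (A + 1)) :=
    lt_of_pow_lt_pow_left₀ 4 (by positivity) ((opNorm_four d ω).trans_lt h4)
  have hR : opNorm (Δ - (k2 / 2) • Mq d ω) < ε / 2 := by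
    refine lt_of_pow_lt_pow_left₀ 2 (by positivity) (((opNorm_frob _).trans ?_).trans_lt hQ)
    unfold Qr
    refine Finset.sum_le_sum fun i _ => Finset.sum_le_sum fun j _ => ?_
    by_cases hij : i = j
    · subst hij
      simp only [hΔ, Matrix.sub_apply, Matrix.of_apply, Matrix.smul_apply, Mq, if_true,
        real_inner_self_eq_norm_sq, sph_norm]
      apply le_of_eq
      simp only [one_pow, smul_eq_mul]
      ring
    · simp only [hΔ, Matrix.sub_apply, Matrix.of_apply, Matrix.smul_apply, Mq, if_neg hij, qk,
        smul_eq_mul]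
      have ht : ⟪(ω i : EuclideanSpace ℝ (Fin d)), (ω j : EuclideanSpace ℝ (Fin d))⟫ ∈
          Set.Icc (-1:ℝ) 1 := by
        have := abs_real_inner_le_norm (ω i : EuclideanSpace ℝ (Fin d))
          (ω j : EuclideanSpace ℝ (Fin d))
        rw [sph_norm, sph_norm, mul_one] at this
        exact abs_le.mp this
      refine le_trans (le_of_eq ?_) (hk _ ht)
      ring
  have e1 : Δ = (k2 / 2) • Mq d ω + (Δ - (k2 / 2) • Mq d ω) := by abel
  rw [e1]
  refine (opNorm_add _ _).trans ?_
  rw [opNorm_smul]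
  have h1 : A * opNorm (Mq d ω) ≤ A * (ε / (2 * (A + 1))) := by gcongr
  have h2 : A * (ε / (2 * (A + 1))) ≤ ε / 2 := by
    rw [← mul_div_assoc, div_le_div_iff₀ (by positivity) (by positivity)]
    nlinarith
  linarith

lemma prob_bound {d n : ℕ} (hd : 0 < d) (k : ℝ → ℝ) (k1 k2 b e : ℝ) (hb : 0 ≤ b) (he : 0 ≤ e)
    (hk : ∀ t ∈ Set.Icc (-1:ℝ) 1,
      (k t - k 0 - k1 * t - k2 / 2 * t ^ 2) ^ 2 ≤ b * t ^ 4 + e * t ^ 6)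
    (ε : ℝ) (hε : 0 < ε) :
    (Measure.pi fun _ : Fin n => uniformSphere d)
      {ω : Fin n → Metric.sphere (0 : EuclideanSpace ℝ (Fin d)) 1 |
        ε < opNorm
        ((Matrix.of fun i j : Fin n =>
            k ⟪(ω i : EuclideanSpace ℝ (Fin d)), (ω j : EuclideanSpace ℝ (Fin d))⟫) -
          (Matrix.of fun i j : Fin n =>
            (k 0 + k2 / (2 * (d : ℝ)))
            + k1 * ⟪(ω i : EuclideanSpace ℝ (Fin d)), (ω j : EuclideanSpace ℝ (Fin d))⟫
            + (k 1 - k 0 - k1) * (if i = j then 1 else 0)))} ≤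
    ENNReal.ofReal (
      (128 * n ^ 2 / (d:ℝ) ^ 3 + 8 * n ^ 3 / (d:ℝ) ^ 4 + 8 * n ^ 4 / (d:ℝ) ^ 6)
        / (ε / (2 * (|k2 / 2| + 1))) ^ 4 +
      (n * (k2 / (2 * (d:ℝ))) ^ 2 + 3 * b * n ^ 2 / (d:ℝ) ^ 2 + 15 * e * n ^ 2 / (d:ℝ) ^ 3)
        / (ε / 2) ^ 2) := by
  have := us_isProb hd
  set a := (k2 / (2 * (d:ℝ))) ^ 2 with ha
  have ha0 : 0 ≤ a := sq_nonneg _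
  set η1 := (ε / (2 * (|k2 / 2| + 1))) ^ 4 with hη1
  set η2 := (ε / 2) ^ 2 with hη2
  have p1 : 0 < η1 := by positivity
  have p2 : 0 < η2 := by positivity
  have sub : {ω : Fin n → Metric.sphere (0 : EuclideanSpace ℝ (Fin d)) 1 |
        ε < opNorm
        ((Matrix.of fun i j : Fin n =>
            k ⟪(ω i : EuclideanSpace ℝ (Fin d)), (ω j : EuclideanSpace ℝ (Fin d))⟫) -
          (Matrix.of fun i j : Fin n =>
            (k 0 + k2 / (2 * (d : ℝ)))
            + k1 * ⟪(ω i : EuclideanSpace ℝ (Fin d)), (ω j : EuclideanSpace ℝ (Fin d))⟫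
            + (k 1 - k 0 - k1) * (if i = j then 1 else 0)))} ⊆
      {ω | η1 ≤ S4 d ω} ∪ {ω | η2 ≤ Qr d a b e ω} := by
    intro ω hω
    by_contra hcon
    simp only [Set.mem_union, Set.mem_setOf_eq, not_or, not_le] at hcon
    exact absurd hω (not_lt.mpr (det_bound k k1 k2 b e hk ω ε hε hcon.1 hcon.2))
  refine (measure_mono sub).trans ((measure_union_le _ _).trans ?_)
  have s0 : ∀ ω : Fin n → Metric.sphere (0 : EuclideanSpace ℝ (Fin d)) 1, 0 ≤ S4 d ω :=
    fun ω => Finset.sum_nonneg fun i _ => Finset.sum_nonneg fun j _ => sq_nonneg _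
  have q0 : ∀ ω : Fin n → Metric.sphere (0 : EuclideanSpace ℝ (Fin d)) 1, 0 ≤ Qr d a b e ω := by
    intro ω
    refine Finset.sum_nonneg fun i _ => Finset.sum_nonneg fun j _ => ?_
    split_ifs
    · exact ha0
    · positivity
  have m1 := mul_meas_ge_le_integral_of_nonneg (μ := smp n d) (Eventually.of_forall s0)
    (smp_int hd _ S4_cont) η1
  have m2 := mul_meas_ge_le_integral_of_nonneg (μ := smp n d) (Eventually.of_forall q0)
    (smp_int hd _ (Qr_cont a b e)) η2
  have b1 := m1.trans (E_S4 hd)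
  have b2 := m2.trans (E_Qr hd a b e ha0 hb he)
  rw [← le_div_iff₀' p1] at b1
  rw [← le_div_iff₀' p2] at b2
  rw [← ofReal_measureReal, ← ofReal_measureReal, ← ENNReal.ofReal_add measureReal_nonneg
    measureReal_nonneg]
  exact ENNReal.ofReal_le_ofReal (add_le_add b1 b2)

lemma lim_bound (c : ℝ) (hc : 0 < c) (d : ℕ → ℕ)
    (hd : Tendsto (fun n : ℕ => (d n : ℝ) / n) atTop (nhds c)) (k2 b e η1 η2 : ℝ) :
    Tendsto (fun n : ℕ =>
      (128 * (n:ℝ) ^ 2 / (d n:ℝ) ^ 3 + 8 * (n:ℝ) ^ 3 / (d n:ℝ) ^ 4 + 8 * (n:ℝ) ^ 4 / (d n:ℝ) ^ 6)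
        / η1 +
      (n * (k2 / (2 * (d n:ℝ))) ^ 2 + 3 * b * (n:ℝ) ^ 2 / (d n:ℝ) ^ 2
        + 15 * e * (n:ℝ) ^ 2 / (d n:ℝ) ^ 3) / η2) atTop (nhds (3 * b * (c⁻¹) ^ 2 / η2)) := by
  have r : Tendsto (fun n : ℕ => (n : ℝ) / (d n : ℝ)) atTop (nhds c⁻¹) := by
    have := hd.inv₀ hc.ne'
    simpa only [inv_div] using this
  have z : Tendsto (fun n : ℕ => 1 / (d n : ℝ)) atTop (nhds 0) := by
    have h := r.mul tendsto_one_div_atTop_nhds_zero_nat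
    rw [mul_zero] at h
    refine h.congr' ?_
    filter_upwards [eventually_gt_atTop 0] with n hn
    have : (n:ℝ) ≠ 0 := by positivity
    rw [div_mul_div_comm, mul_one, mul_comm (d n : ℝ), div_mul_eq_div_div, div_self this]
  have lim : Tendsto (fun n : ℕ =>
      (128 * ((n : ℝ) / (d n : ℝ)) ^ 2 * (1 / (d n : ℝ))
        + 8 * ((n : ℝ) / (d n : ℝ)) ^ 3 * (1 / (d n : ℝ))
        + 8 * ((n : ℝ) / (d n : ℝ)) ^ 4 * (1 / (d n : ℝ)) ^ 2) / η1 +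
      (k2 ^ 2 / 4 * ((n : ℝ) / (d n : ℝ)) * (1 / (d n : ℝ)) + 3 * b * ((n : ℝ) / (d n : ℝ)) ^ 2
        + 15 * e * ((n : ℝ) / (d n : ℝ)) ^ 2 * (1 / (d n : ℝ))) / η2) atTop
      (nhds ((128 * (c⁻¹) ^ 2 * 0 + 8 * (c⁻¹) ^ 3 * 0 + 8 * (c⁻¹) ^ 4 * 0 ^ 2) / η1 +
      (k2 ^ 2 / 4 * c⁻¹ * 0 + 3 * b * (c⁻¹) ^ 2 + 15 * e * (c⁻¹) ^ 2 * 0) / η2)) := by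
    refine Tendsto.add (Tendsto.div_const (Tendsto.add (Tendsto.add ?_ ?_) ?_) _)
      (Tendsto.div_const (Tendsto.add (Tendsto.add ?_ ?_) ?_) _)
    · exact ((r.pow 2).const_mul _).mul z
    · exact ((r.pow 3).const_mul _).mul z
    · exact ((r.pow 4).const_mul _).mul (z.pow 2)
    · exact (r.const_mul _).mul z
    · exact (r.pow 2).const_mul _
    · exact ((r.pow 2).const_mul _).mul z
  have hl : (128 * (c⁻¹) ^ 2 * 0 + 8 * (c⁻¹) ^ 3 * 0 + 8 * (c⁻¹) ^ 4 * 0 ^ 2) / η1 +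
      (k2 ^ 2 / 4 * c⁻¹ * 0 + 3 * b * (c⁻¹) ^ 2 + 15 * e * (c⁻¹) ^ 2 * 0) / η2
      = 3 * b * (c⁻¹) ^ 2 / η2 := by ring
  rw [hl] at lim
  refine lim.congr fun n => ?_
  ring

end Final

theorem stmt_15 (σa : ℝ) (hσ0 : 0 < σa ^ 2) (hσ1 : σa ^ 2 < 1)
    (c : ℝ) (hc : 0 < c) (d : ℕ → ℕ)
    (hd : Tendsto (fun n : ℕ => (d n : ℝ) / n) atTop (nhds c))
    (g : ℝ → ℝ)
    (hg : ∀ t ∈ Set.Icc (-1 : ℝ) 1,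
      g t ∈ Set.Icc (-1 : ℝ) 1 ∧ g t = σa ^ 2 * fDual (g t) + (1 - σa ^ 2) * t) :
    ∀ ε > (0 : ℝ),
      Tendsto
        (fun n : ℕ =>
          (Measure.pi fun _ : Fin n => uniformSphere (d n))
            {ω : Fin n → Metric.sphere (0 : EuclideanSpace ℝ (Fin (d n))) 1 |
              ε < opNorm
                ((Matrix.of fun i j : Fin n =>
                    (hNTK σa ∘ g) ⟪(ω i : EuclideanSpace ℝ (Fin (d n))),
                                   (ω j : EuclideanSpace ℝ (Fin (d n)))⟫) -
                 (Matrix.of fun i j : Fin n =>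
                    ((hNTK σa ∘ g) 0
                        + deriv (deriv (hNTK σa ∘ g)) 0 / (2 * (d n : ℝ)))
                      + deriv (hNTK σa ∘ g) 0 *
                          ⟪(ω i : EuclideanSpace ℝ (Fin (d n))),
                           (ω j : EuclideanSpace ℝ (Fin (d n)))⟫
                      + ((hNTK σa ∘ g) 1 - (hNTK σa ∘ g) 0 - deriv (hNTK σa ∘ g) 0) *
                          (if i = j then 1 else 0)))})
        atTop (nhds 0) := by
  intro ε hε
  rw [ENNReal.tendsto_nhds_zero]
  intro δ hδ
  obtain ⟨δ', hδ'0, hδ'⟩ := ENNReal.lt_iff_exists_nnreal_btwn.mp hδ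
  have hδp : (0:ℝ) < δ' := by exact_mod_cast hδ'0
  set k := hNTK σa ∘ g with hk
  set k1 := deriv k 0 with hk1
  set k2 := deriv (deriv k) 0 with hk2
  have hη2 : 0 < (ε / 2) ^ 2 := by positivity
  obtain ⟨b, hb, hb2⟩ : ∃ b : ℝ, 0 < b ∧ 3 * b * (c⁻¹) ^ 2 / (ε / 2) ^ 2 < δ' := by
    refine ⟨δ' * (ε / 2) ^ 2 * c ^ 2 / 6, by positivity, ?_⟩
    have : 3 * (δ' * (ε / 2) ^ 2 * c ^ 2 / 6) * (c⁻¹) ^ 2 / (ε / 2) ^ 2 = (δ' : ℝ) / 2 := by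
      field_simp
      norm_num
    rw [this]
    linarith
  obtain ⟨e, he, hrem⟩ := k_rem σa hσ1 g hg b hb
  have hlim := lim_bound c hc d hd k2 b e ((ε / (2 * (|k2 / 2| + 1))) ^ 4) ((ε / 2) ^ 2)
  filter_upwards [hlim.eventually_lt_const hb2, hd.eventually_const_lt hc] with n hn hdn
  have hdpos : 0 < d n := by
    rcases Nat.eq_zero_or_pos (d n) with h | h
    · rw [h] at hdn; simp at hdn
    · exact h
  refine (prob_bound (n := n) hdpos k k1 k2 b e hb.le he hrem ε hε).trans ?_
  refine (ENNReal.ofReal_le_ofReal hn.le).trans ?_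
  rw [ENNReal.ofReal_coe_nnreal]
  exact hδ'.le
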